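/- Let G be a Δ-critical simple graph, ε ∈ (0,1), q = (1−ε)Δ, and let xy ∈ E(G) with d(x) < εΔ and φ ∈ C^Δ(G−xy). If (⋃_{z ∈ N(x, M_φ)} φ_b(z)) ∩ B_φ(x,y,q) = B_φ(x,y,q) and |B_φ(x,y,q)| = 2, then there exists at least one z' ∈ N(x, B_φ) such that every u ∈ N(z')−{x} satisfies d(u) ≥ q. -/

import Mathlib

open Finset

variable {V : Type*}

/-- `φ` is a proper edge coloring of `G` with colors in `{1, …, k}`, encoded as a symmetric
function on ordered pairs of vertices: every edge receives a color in `[1,k]` and two distinct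
edges sharing a vertex receive different colors. -/
def IsEdgeColoring (G : SimpleGraph V) (k : ℕ) (φ : V → V → ℕ) : Prop :=
  (∀ u v, φ u v = φ v u) ∧
  (∀ ⦃u v⦄, G.Adj u v → φ u v ∈ Finset.Icc 1 k) ∧
  (∀ ⦃v a b⦄, G.Adj v a → G.Adj v b → a ≠ b → φ v a ≠ φ v b)

/-- The chromatic index of `G`: the least `k` such that `G` has a proper edge `k`-coloring. -/
noncomputable def chromIndex (G : SimpleGraph V) : ℕ :=
  sInf {k | ∃ φ : V → V → ℕ, IsEdgeColoring G k φ}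

/-- `G` is `Δ`-critical: `G` is connected, `χ'(G) = Δ + 1`, and `χ'(G - e) = Δ` for every
edge `e` of `G`, where `Δ` is the maximum degree of `G`. -/
def IsDeltaCritical [Fintype V] (G : SimpleGraph V) [DecidableRel G.Adj] : Prop :=
  G.Connected ∧ chromIndex G = G.maxDegree + 1 ∧
    ∀ e ∈ G.edgeSet, chromIndex (G.deleteEdges {e}) = G.maxDegree

/-- The independence number of `G`. -/
noncomputable def indepNum [Fintype V] (G : SimpleGraph V) : ℕ :=
  sSup {n | ∃ s : Finset V, (∀ u ∈ s, ∀ v ∈ s, u ≠ v → ¬ G.Adj u v) ∧ s.card = n}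

/-- The set of colors present at `v` in the graph `H` under the coloring `φ`. -/
def present (H : SimpleGraph V) (φ : V → V → ℕ) (v : V) : Set ℕ :=
  {c | ∃ u, H.Adj v u ∧ φ v u = c}

/-- The set of colors in `[1,Δ]` missing at `v` in the graph `H` under the coloring `φ`. -/
def missing (H : SimpleGraph V) (Δ : ℕ) (φ : V → V → ℕ) (v : V) : Set ℕ :=
  Set.Icc 1 Δ \ present H φ v

variable [Fintype V]

/-- `A_φ(x,y,q)`: colors `α` present at `x` such that some colored edge `yu` has color `α`
with `d(u) < q` (degrees taken in `G`, the coloring living on `H = G - xy`). -/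
def Aset (G H : SimpleGraph V) [DecidableRel G.Adj] (φ : V → V → ℕ) (q : ℝ) (x y : V) :
    Set ℕ :=
  {α | α ∈ present H φ x ∧ ∃ u, H.Adj y u ∧ φ y u = α ∧ (G.degree u : ℝ) < q}

/-- `B_φ(x,y,q)`: colors `β` present at `x` such that some colored edge `yu` has color `β`
with `d(u) ≥ q`. -/
def Bset (G H : SimpleGraph V) [DecidableRel G.Adj] (φ : V → V → ℕ) (q : ℝ) (x y : V) :
    Set ℕ :=
  {β | β ∈ present H φ x ∧ ∃ u, H.Adj y u ∧ φ y u = β ∧ q ≤ (G.degree u : ℝ)}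

/-- `M_φ(x,y,q) = A_φ(x,y,q) ∪ φ̄(x) ∪ φ̄(y)`. -/
def Mset (G H : SimpleGraph V) [DecidableRel G.Adj] (Δ : ℕ) (φ : V → V → ℕ) (q : ℝ)
    (x y : V) : Set ℕ :=
  Aset G H φ q x y ∪ missing H Δ φ x ∪ missing H Δ φ y

/-- `N(x, M_φ)`: neighbors `z` of `x` (in `H = G - xy`) with `φ(xz) ∈ M_φ(x,y,q)`. -/
def NxM (G H : SimpleGraph V) [DecidableRel G.Adj] (Δ : ℕ) (φ : V → V → ℕ) (q : ℝ)
    (x y : V) : Set V :=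
  {z | H.Adj x z ∧ φ x z ∈ Mset G H Δ φ q x y}

/-- `N(x, B_φ)`: neighbors `z` of `x` (in `H = G - xy`) with `φ(xz) ∈ B_φ(x,y,q)`. -/
def NxB (G H : SimpleGraph V) [DecidableRel G.Adj] (φ : V → V → ℕ) (q : ℝ) (x y : V) :
    Set V :=
  {z | H.Adj x z ∧ φ x z ∈ Bset G H φ q x y}

/-- `φ_b(v)`: colors `α ∈ [1,Δ]` that are either missing at `v`, or appear on a colored edge
`vv'` with `d(v') < q`. -/
def phib (G H : SimpleGraph V) [DecidableRel G.Adj] (Δ : ℕ) (φ : V → V → ℕ) (q : ℝ)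
    (v : V) : Set ℕ :=
  {α | α ∈ Set.Icc 1 Δ ∧
    (α ∉ present H φ v ∨ ∃ v', H.Adj v v' ∧ φ v v' = α ∧ (G.degree v' : ℝ) < q)}

set_option linter.unusedSectionVars false
set_option linter.unusedVariables false

section Helpers
variable {V : Type*}

/-- Colorings of `G - xy` as total functions with `0` on uncolored pairs. -/
structure St (G : SimpleGraph V) (k : ℕ) (x y : V) (φ : V → V → ℕ) : Prop where
  adj : G.Adj x y
  symm : ∀ u v, φ u v = φ v u
  le : ∀ u v, φ u v ≤ k
  ne0 : ∀ u v, φ u v ≠ 0 ↔ G.Adj u v ∧ ¬ ((u = x ∧ v = y) ∨ (u = y ∧ v = x))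
  proper : ∀ v a b, φ v a = φ v b → φ v a ≠ 0 → a = b

/-- The color `c` is missing at `v`. -/
def Miss (φ : V → V → ℕ) (v : V) (c : ℕ) : Prop := ∀ a, φ v a ≠ c

/-- The color `c` is missing at `v` or leads to a small vertex. -/
def Pb (small : V → Prop) (x : V) (φ : V → V → ℕ) (v : V) (c : ℕ) : Prop :=
  Miss φ v c ∨ ∃ w, small w ∧ w ≠ x ∧ φ v w = c

/-- What is used of criticality and of the degree conditions. -/
structure Ctx (G : SimpleGraph V) (k : ℕ) (x : V) (small : V → Prop) : Prop where
  nc : ∀ y φ, St G k x y φ → ∀ c, c ≠ 0 → c ≤ k → Miss φ x c → Miss φ y c → False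
  two : ∀ y φ, St G k x y φ → ∀ u, small u → u ≠ x → ∀ f,
    ∃ δ, δ ≠ f ∧ δ ≠ 0 ∧ δ ≤ k ∧ Miss φ x δ ∧ Miss φ u δ
  nsm : ∀ y φ, St G k x y φ → ¬ small y
  ymiss : ∀ y φ, St G k x y φ → ∃ γ, γ ≠ 0 ∧ γ ≤ k ∧ Miss φ y γ

lemma St.irr {G : SimpleGraph V} {k : ℕ} {x y : V} {φ : V → V → ℕ} (h : St G k x y φ) (p : V) :
    φ p p = 0 := by
  by_contra hne
  exact G.loopless.irrefl p ((h.ne0 p p).1 hne).1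

lemma St.xy0 {G : SimpleGraph V} {k : ℕ} {x y : V} {φ : V → V → ℕ} (h : St G k x y φ) :
    φ x y = 0 := by
  by_contra hne
  exact ((h.ne0 x y).1 hne).2 (Or.inl ⟨rfl, rfl⟩)

lemma St.yx0 {G : SimpleGraph V} {k : ℕ} {x y : V} {φ : V → V → ℕ} (h : St G k x y φ) :
    φ y x = 0 := by rw [h.symm]; exact h.xy0

open Classical in
lemma three_leaf [Fintype V] (D : SimpleGraph V) (h2 : ∀ p, D.degree p ≤ 2) (x y u : V)
    (hxy : x ≠ y) (hxu : x ≠ u) (hyu : y ≠ u) (hx : D.degree x ≤ 1) (hy : D.degree y ≤ 1)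
    (hu : D.degree u ≤ 1) (rxy : D.Reachable x y) (rxu : D.Reachable x u) : False := by
  let c := D.connectedComponentMk x
  let K : Finset V := Finset.univ.filter (fun p => D.Reachable x p)
  let F := D.induce {p | D.Reachable x p}
  have hcon : F.Connected := by
    have := c.connected_toSimpleGraph
    have he : c.supp = {p | D.Reachable x p} := by
      ext p
      simp only [c, SimpleGraph.ConnectedComponent.mem_supp_iff, SimpleGraph.ConnectedComponent.eq,
        Set.mem_ofPred_eq]
      exact ⟨fun h => h.symm, fun h => h.symm⟩
    have h3 : (D.induce c.supp).Connected := this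
    rw [he] at h3
    exact h3
  have h1 := hcon.card_vert_le_card_edgeSet_add_one
  have hs := F.sum_degrees_eq_twice_card_edges
  have hdeg : ∀ p : {p | D.Reachable x p}, F.degree p ≤ D.degree p.1 := by
    intro p
    rw [← SimpleGraph.card_neighborFinset_eq_degree, ← SimpleGraph.card_neighborFinset_eq_degree]
    apply Finset.card_le_card_of_injOn (fun a => a.1)
    · intro a ha
      simpa [F] using ha
    · intro a _ b _ hab
      exact Subtype.ext hab
  let X : {p | D.Reachable x p} := ⟨x, SimpleGraph.Reachable.refl x⟩
  let Y : {p | D.Reachable x p} := ⟨y, rxy⟩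
  let U : {p | D.Reachable x p} := ⟨u, rxu⟩
  have hXY : X ≠ Y := fun h => hxy (congrArg Subtype.val h)
  have hXU : X ≠ U := fun h => hxu (congrArg Subtype.val h)
  have hYU : Y ≠ U := fun h => hyu (congrArg Subtype.val h)
  have hle : ∑ p, F.degree p + ∑ p : {p | D.Reachable x p}, (if p ∈ ({X, Y, U} : Finset _) then 1 else 0)
      ≤ ∑ p : {p | D.Reachable x p}, 2 := by
    rw [← Finset.sum_add_distrib]
    apply Finset.sum_le_sum
    intro p _
    have h5 := hdeg p
    split_ifs with hp
    · simp only [Finset.mem_insert, Finset.mem_singleton] at hp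
      rcases hp with rfl | rfl | rfl
      · exact Nat.succ_le_succ (h5.trans hx)
      · exact Nat.succ_le_succ (h5.trans hy)
      · exact Nat.succ_le_succ (h5.trans hu)
    · exact h5.trans (h2 _)
  have hc3 : ∑ p : {p | D.Reachable x p}, (if p ∈ ({X, Y, U} : Finset _) then 1 else 0) = 3 := by
    rw [Finset.sum_ite_mem, Finset.univ_inter, Finset.sum_const, Finset.card_eq_three.2 ⟨X, Y, U, hXY, hXU, hYU, rfl⟩]
    rfl
  rw [hs, hc3] at hle
  simp only [Finset.sum_const, Finset.card_univ, smul_eq_mul] at hle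
  rw [Nat.card_eq_fintype_card, Nat.card_eq_fintype_card, ← SimpleGraph.edgeFinset_card] at h1
  omega

/-- The `γ`-`δ` Kempe graph. -/
def Kg {G : SimpleGraph V} {k : ℕ} {x y : V} {φ : V → V → ℕ} (h : St G k x y φ) (γ δ : ℕ)
    (hγ : γ ≠ 0) (hδ : δ ≠ 0) : SimpleGraph V where
  Adj p r := φ p r = γ ∨ φ p r = δ
  symm := ⟨fun p r hpr => by rw [h.symm r p]; exact hpr⟩
  loopless := ⟨fun p hp => by rw [h.irr] at hp; rcases hp with hp | hp <;> omega⟩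

open Classical in
/-- Kempe change on the component of `u`. -/
noncomputable def kswap {G : SimpleGraph V} {k : ℕ} {x y : V} {φ : V → V → ℕ}
    (h : St G k x y φ) (γ δ : ℕ)
    (hγ : γ ≠ 0) (hδ : δ ≠ 0) (u : V) : V → V → ℕ := fun p r =>
  if (Kg h γ δ hγ hδ).Reachable u p then Equiv.swap γ δ (φ p r) else φ p r

lemma kswap_or {G : SimpleGraph V} {k : ℕ} {x y : V} {φ : V → V → ℕ}
    (h : St G k x y φ) (γ δ : ℕ) (hγ : γ ≠ 0) (hδ : δ ≠ 0) (u p r : V) :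
    kswap h γ δ hγ hδ u p r = φ p r ∨ kswap h γ δ hγ hδ u p r = Equiv.swap γ δ (φ p r) := by
  unfold kswap
  split_ifs <;> simp

lemma kswap_st {G : SimpleGraph V} {k : ℕ} {x y : V} {φ : V → V → ℕ}
    (h : St G k x y φ) (γ δ : ℕ) (hγ : γ ≠ 0) (hδ : δ ≠ 0) (gk : γ ≤ k) (dk : δ ≤ k) (u : V) :
    St G k x y (kswap h γ δ hγ hδ u) := by
  have key0 : ∀ n : ℕ, Equiv.swap γ δ n = 0 ↔ n = 0 := by
    intro n
    rw [Equiv.swap_apply_def]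
    split_ifs <;> omega
  refine ⟨h.adj, ?_, ?_, ?_, ?_⟩
  · intro p r
    by_cases hc : φ p r = γ ∨ φ p r = δ
    · have hadj : (Kg h γ δ hγ hδ).Adj p r := hc
      have : (Kg h γ δ hγ hδ).Reachable u p ↔ (Kg h γ δ hγ hδ).Reachable u r :=
        ⟨fun t => t.trans hadj.reachable, fun t => t.trans hadj.symm.reachable⟩
      unfold kswap
      by_cases t : (Kg h γ δ hγ hδ).Reachable u p
      · rw [if_pos t, if_pos (this.1 t), h.symm p r]
      · rw [if_neg t, if_neg (fun t' => t (this.2 t')), h.symm p r]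
    · push Not at hc
      have h1 : Equiv.swap γ δ (φ p r) = φ p r := Equiv.swap_apply_of_ne_of_ne hc.1 hc.2
      have h2 : Equiv.swap γ δ (φ r p) = φ r p := by rw [h.symm r p]; exact h1
      unfold kswap
      simp only [h2, ite_self, h.symm p r]
  · intro p r
    have := h.le p r
    rcases kswap_or h γ δ hγ hδ u p r with e | e <;> rw [e]
    · exact this
    · rw [Equiv.swap_apply_def]; split_ifs <;> omega
  · intro p r
    rw [← h.ne0 p r]
    rcases kswap_or h γ δ hγ hδ u p r with e | e <;> rw [e]
    rw [Ne, key0]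
  · intro v a b hab hne
    unfold kswap at hab hne
    split_ifs at hab hne with hr
    · exact h.proper v a b ((Equiv.swap γ δ).injective hab) (fun h0 => hne ((key0 _).2 h0))
    · exact h.proper v a b hab hne

open Classical in
lemma deg_le_card [Fintype V] {G : SimpleGraph V} {k : ℕ} {x y : V} {φ : V → V → ℕ}
    (h : St G k x y φ) (γ δ : ℕ) (hγ : γ ≠ 0) (hδ : δ ≠ 0) (p : V) (S : Finset ℕ)
    (hS : ∀ a, φ p a = γ ∨ φ p a = δ → φ p a ∈ S) : (Kg h γ δ hγ hδ).degree p ≤ S.card := by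
  rw [← SimpleGraph.card_neighborFinset_eq_degree]
  apply Finset.card_le_card_of_injOn (fun a => φ p a)
  · intro a ha
    have ha' : φ p a = γ ∨ φ p a = δ := by
      rw [Finset.mem_coe, SimpleGraph.mem_neighborFinset] at ha; exact ha
    exact hS a ha'
  · intro a ha b _ hab
    have ha' : φ p a = γ ∨ φ p a = δ := by
      rw [Finset.mem_coe, SimpleGraph.mem_neighborFinset] at ha; exact ha
    exact h.proper p a b hab (by rcases ha' with e | e <;> rw [e] <;> assumption)

/-- Kempe change at `u`, avoiding `x` and `y`. -/
lemma kempe [Fintype V] {G : SimpleGraph V} {k : ℕ} {x y : V} {small : V → Prop}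
    (C : Ctx G k x small) {φ : V → V → ℕ}
    (h : St G k x y φ) {γ δ : ℕ} (hγ : γ ≠ 0) (hδ : δ ≠ 0) (gk : γ ≤ k) (dk : δ ≤ k)
    (my : Miss φ y γ) (mx : Miss φ x δ) (u : V) (hux : u ≠ x) (huy : u ≠ y)
    (mu : Miss φ u δ) :
    ∃ φ', St G k x y φ' ∧ (∀ a, φ' x a = φ x a) ∧ (∀ a, φ' y a = φ y a) ∧
      (∀ a, φ' u a = Equiv.swap γ δ (φ u a)) ∧
      (∀ p r, φ' p r = φ p r ∨ φ' p r = Equiv.swap γ δ (φ p r)) := by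
  classical
  have hne : γ ≠ δ := by
    rintro rfl
    exact C.nc y φ h γ hγ gk mx my
  have hxy : x ≠ y := h.adj.ne
  have r1 : (Kg h γ δ hγ hδ).Reachable x y := by
    by_contra hr
    refine C.nc y _ (kswap_st h γ δ hγ hδ gk dk x) γ hγ gk ?_ ?_
    · intro a ha
      unfold kswap at ha
      rw [if_pos (SimpleGraph.Reachable.refl x)] at ha
      exact mx a ((Equiv.swap γ δ).injective (ha.trans (Equiv.swap_apply_right γ δ).symm))
    · intro a ha
      unfold kswap at ha
      rw [if_neg hr] at ha
      exact my a ha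
  have r2 : ¬ (Kg h γ δ hγ hδ).Reachable x u := by
    intro r
    refine three_leaf (Kg h γ δ hγ hδ) ?_ x y u hxy hux.symm huy.symm ?_ ?_ ?_ r1 r
    · intro p
      exact (deg_le_card h γ δ hγ hδ p {γ, δ} (fun a ha => by simpa using ha)).trans
        (Finset.card_le_two)
    · refine (deg_le_card h γ δ hγ hδ x {γ} (fun a ha => ?_))
      have := mx a
      simp; tauto
    · refine (deg_le_card h γ δ hγ hδ y {δ} (fun a ha => ?_))
      have := my a
      simp; tauto
    · refine (deg_le_card h γ δ hγ hδ u {γ} (fun a ha => ?_))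
      have := mu a
      simp; tauto
  refine ⟨_, kswap_st h γ δ hγ hδ gk dk u, ?_, ?_, ?_, fun p r => kswap_or h γ δ hγ hδ u p r⟩
  · intro a
    unfold kswap
    rw [if_neg (fun t => r2 t.symm)]
  · intro a
    unfold kswap
    rw [if_neg (fun t => r2 (r1.trans t.symm))]
  · intro a
    unfold kswap
    rw [if_pos (SimpleGraph.Reachable.refl u)]

lemma St.miss0 {G : SimpleGraph V} {k : ℕ} {x y : V} {φ : V → V → ℕ} (h : St G k x y φ) {v : V}
    {c : ℕ} (m : Miss φ v c) : c ≠ 0 := by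
  rintro rfl
  exact m v (h.irr v)

/-- Two colorings differ only within the color set `T`. -/
def Sim (T : ℕ → Prop) (φ φ' : V → V → ℕ) : Prop :=
  ∀ p r, φ p r = φ' p r ∨ (T (φ p r) ∧ T (φ' p r))

lemma Sim.trans {T : ℕ → Prop} {φ φ' φ'' : V → V → ℕ} (h : Sim T φ φ') (h' : Sim T φ' φ'') :
    Sim T φ φ'' := by
  intro p r
  have h1 := h p r
  have h2 := h' p r
  grind

lemma Sim.mono {T T' : ℕ → Prop} {φ φ' : V → V → ℕ} (h : Sim T φ φ') (hT : ∀ c, T c → T' c) :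
    Sim T' φ φ' := by
  intro p r
  have h1 := h p r
  grind

lemma Sim.keep {T : ℕ → Prop} {φ φ' : V → V → ℕ} (h : Sim T φ φ') {c : ℕ} (hc : ¬ T c)
    (p r : V) : φ p r = c ↔ φ' p r = c := by
  have h1 := h p r
  grind

lemma Sim.pb {T : ℕ → Prop} {φ φ' : V → V → ℕ} (h : Sim T φ φ') {c : ℕ} (hc : ¬ T c)
    {small : V → Prop} {x v : V} : Pb small x φ v c ↔ Pb small x φ' v c := by
  simp only [Pb, Miss, Ne, h.keep hc]

lemma sim_swap {φ φ' : V → V → ℕ} {γ δ : ℕ}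
    (h : ∀ p r, φ' p r = φ p r ∨ φ' p r = Equiv.swap γ δ (φ p r)) :
    Sim (fun c => c = γ ∨ c = δ) φ φ' := by
  intro p r
  have h1 := h p r
  rw [Equiv.swap_apply_def] at h1
  grind

open Classical in
/-- Recoloring the edge `yw` with `c`. -/
noncomputable def recol (φ : V → V → ℕ) (y w : V) (c : ℕ) : V → V → ℕ := fun p r =>
  if (p = y ∧ r = w) ∨ (p = w ∧ r = y) then c else φ p r

lemma recol_st {G : SimpleGraph V} {k : ℕ} {x y : V} {φ : V → V → ℕ} (h : St G k x y φ)
    {w : V} {c : ℕ} (hw : φ y w ≠ 0) (ck : c ≤ k) (my : Miss φ y c) (mw : Miss φ w c) :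
    St G k x y (recol φ y w c) := by
  have c0 := h.miss0 my
  have hwy : φ w y ≠ 0 := by rw [h.symm]; exact hw
  have n1 := (h.ne0 y w).1 hw
  have n2 := (h.ne0 w y).1 hwy
  refine ⟨h.adj, ?_, ?_, ?_, ?_⟩
  · intro p r
    have := h.symm p r
    unfold recol
    grind
  · intro p r
    have := h.le p r
    unfold recol
    grind
  · intro p r
    have := h.ne0 p r
    unfold recol
    grind
  · intro v a b
    have h1 := h.proper v a b
    have h2 := my a
    have h3 := my b
    have h4 := mw a
    have h5 := mw b
    unfold recol
    grind

open Classical in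
/-- Shifting the uncolored edge from `xy` to `xz`. -/
noncomputable def rot (φ : V → V → ℕ) (x y z : V) (α : ℕ) : V → V → ℕ := fun p r =>
  if (p = x ∧ r = y) ∨ (p = y ∧ r = x) then α else
  if (p = x ∧ r = z) ∨ (p = z ∧ r = x) then 0 else φ p r

lemma rot_st {G : SimpleGraph V} {k : ℕ} {x y : V} {φ : V → V → ℕ} (h : St G k x y φ)
    {z : V} {α : ℕ} (hz : φ x z = α) (my : Miss φ y α) :
    St G k x z (rot φ x y z α) := by
  have c0 := h.miss0 my
  have hxy := h.adj.ne
  have hwy : φ z x ≠ 0 := by rw [h.symm, hz]; exact c0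
  have n1 := (h.ne0 x z).1 (by rw [hz]; exact c0)
  have n2 := (h.ne0 z x).1 hwy
  have hadj := h.adj
  have hadj' := h.adj.symm
  refine ⟨n1.1, ?_, ?_, ?_, ?_⟩
  · intro p r
    have := h.symm p r
    unfold rot
    grind
  · intro p r
    have := h.le p r
    have := h.le x z
    unfold rot
    grind
  · intro p r
    have := h.ne0 p r
    unfold rot
    grind
  · intro v a b
    have h1 := h.proper v a b
    have h2 := my a
    have h3 := my b
    have h4 := h.proper x z a
    have h5 := h.proper x z b
    unfold rot
    grind

variable [Fintype V] {G : SimpleGraph V} {k : ℕ} {x y : V} {small : V → Prop}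
    {φ : V → V → ℕ}

/-- Making the color of an edge to a small vertex missing at `y`. -/
lemma smallStep (C : Ctx G k x small) (h : St G k x y φ) {γ c : ℕ} (gk : γ ≤ k)
    (my : Miss φ y γ) {w : V} (sw : small w) (hwx : w ≠ x) (hc : φ y w = c) (c0 : c ≠ 0) :
    ∃ φ', St G k x y φ' ∧ (∀ a, φ' x a = φ x a) ∧ Miss φ' y c ∧ φ' y w = γ ∧
      (∀ a, a ≠ w → φ' y a = φ y a) ∧
      (∀ p r, ¬ ((p = y ∧ r = w) ∨ (p = w ∧ r = y)) → φ p r = φ' p r ∨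
        ((φ p r = γ ∨ Miss φ x (φ p r)) ∧ (φ' p r = γ ∨ Miss φ x (φ' p r)))) := by
  have g0 := h.miss0 my
  obtain ⟨δ, -, d0, dk, mxd, mwd⟩ := C.two y φ h w sw hwx 0
  have hwy : w ≠ y := by
    rintro rfl
    exact C.nsm w φ h sw
  obtain ⟨φ1, h1, e1, e2, e3, e4⟩ := kempe C h g0 d0 gk dk my mxd w hwx hwy mwd
  have my1 : Miss φ1 y γ := fun a => by rw [e2]; exact my a
  have mw1 : Miss φ1 w γ := fun a ha => by
    rw [e3] at ha
    exact mwd a ((Equiv.swap γ δ).injective (ha.trans (Equiv.swap_apply_right γ δ).symm))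
  have hyx : y ≠ x := h.adj.ne.symm
  have sim := sim_swap e4
  refine ⟨recol φ1 y w γ, recol_st h1 (by rw [e2, hc]; exact c0) gk my1 mw1, ?_, ?_, ?_, ?_, ?_⟩
  · intro a
    have := e1 a
    unfold recol
    grind
  · intro a
    have h3 := h.proper y w a
    have h4 := e2 a
    have h5 := my w
    unfold recol
    grind
  · unfold recol
    simp
  · intro a ha
    have := e2 a
    unfold recol
    grind
  · intro p r hpr
    have h3 := sim p r
    unfold recol
    rw [if_neg hpr]
    grind

lemma base (C : Ctx G k x small) (h : St G k x y φ) {c : ℕ}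
    {w : V} (sw : small w) (hwx : w ≠ x) (hc : φ y w = c) (mx : Miss φ x c) : False := by
  obtain ⟨γ, -, gk, my⟩ := C.ymiss y φ h
  have c0 := h.miss0 mx
  have ck : c ≤ k := hc ▸ h.le y w
  obtain ⟨φ', h', ex, m, -⟩ := smallStep C h gk my sw hwx hc c0
  exact C.nc y φ' h' c c0 ck (fun a => by rw [ex]; exact mx a) m

/-- Converting the color of a small edge into one missing at `x`. -/
lemma conv (C : Ctx G k x small) (h : St G k x y φ) {α c : ℕ} (ak : α ≤ k)
    (mα : Miss φ y α) (hca : c ≠ α) (pb : Pb small x φ y c) {z u : V} (su : small u)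
    (hux : u ≠ x) (hz : z ≠ y) (hc : φ z u = c) (c0 : c ≠ 0) :
    ∃ φ', St G k x y φ' ∧ (∀ a, φ' x a = φ x a) ∧ Miss φ' y α ∧ Miss φ x (φ' z u) ∧
      Sim (fun e => Miss φ x e ∨ e = α ∨ e = c) φ φ' := by
  have ck : c ≤ k := hc ▸ h.le z u
  have huy : u ≠ y := by
    rintro rfl
    exact C.nsm u φ h su
  rcases pb with m | ⟨w, sw, hwx, hw⟩
  · obtain ⟨b, -, b0, bk, mxb, mub⟩ := C.two y φ h u su hux 0
    obtain ⟨φ1, h1, e1, e2, e3, e4⟩ := kempe C h c0 b0 ck bk m mxb u hux huy mub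
    refine ⟨φ1, h1, e1, fun a => by rw [e2]; exact mα a, ?_, (sim_swap e4).mono ?_⟩
    · rw [h1.symm, e3, h.symm, hc, Equiv.swap_apply_left]
      exact mxb
    · rintro e (rfl | rfl)
      · exact Or.inr (Or.inr rfl)
      · exact Or.inl mxb
  · have hwy : w ≠ y := by
      rintro rfl
      exact C.nsm w φ h sw
    have a0 := h.miss0 mα
    have mxc : ¬ Miss φ x c := fun m => base C h sw hwx hw m
    obtain ⟨φ1, h1, x1, m1, w1, y1, s1⟩ := smallStep C h ak mα sw hwx hw c0
    have hc1 : φ1 z u = c := by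
      have := s1 z u
      grind
    have S1 : Sim (fun e => Miss φ x e ∨ e = α ∨ e = c) φ φ1 := by
      intro p r
      have t1 := s1 p r
      have t2 := h.symm y w
      have t3 := h1.symm y w
      grind
    obtain ⟨b, -, b0, bk, mxb, mub⟩ := C.two y φ1 h1 u su hux 0
    obtain ⟨φ2, h2, x2, y2, e2, s2⟩ := kempe C h1 c0 b0 ck bk m1 mxb u hux huy mub
    have hc2 : φ2 z u = b := by
      rw [h2.symm, e2, h1.symm, hc1, Equiv.swap_apply_left]
    have m2 : Miss φ2 y c := fun a => by rw [y2]; exact m1 a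
    obtain ⟨a, hab, a0', ak', mxa, mwa⟩ := C.two y φ2 h2 w sw hwx b
    obtain ⟨φ3, h3, x3, y3, e3, s3⟩ := kempe C h2 c0 a0' ck ak' m2 mxa w hwx hwy mwa
    have m3 : Miss φ3 y c := fun a => by rw [y3]; exact m2 a
    have hbc : b ≠ c := fun e => by
      apply mxc
      rw [← e]
      intro d
      rw [← x1]; exact mxb d
    have hc3 : φ3 z u = b := by
      rw [← (sim_swap s3).keep (c := b) (by rintro (e | e); exact hbc e; exact hab e.symm)]
      exact hc2
    have mw3 : Miss φ3 w c := fun d hd => by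
      rw [e3] at hd
      exact mwa d ((Equiv.swap c a).injective (hd.trans (Equiv.swap_apply_right c a).symm))
    have mxb' : Miss φ x b := fun d => by rw [← x1]; exact mxb d
    have mxa' : Miss φ x a := fun d => by rw [← x1, ← x2]; exact mxa d
    have w3 : φ3 y w = α := by rw [y3, y2, w1]
    have hyx : y ≠ x := h.adj.ne.symm
    refine ⟨recol φ3 y w c, recol_st h3 (by rw [w3]; exact a0) ck m3 mw3, ?_, ?_, ?_, ?_⟩
    · intro d
      have t1 := x1 d
      have t2 := x2 d
      have t3 := x3 d
      unfold recol
      grind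
    · intro d
      have t := h3.proper y w d
      unfold recol
      grind
    · have : recol φ3 y w c z u = b := by
        unfold recol
        grind
      rw [this]
      exact mxb'
    · refine ((S1.trans ((sim_swap s2).mono ?_)).trans ((sim_swap s3).mono ?_)).trans ?_
      · rintro e (rfl | rfl)
        · exact Or.inr (Or.inr rfl)
        · exact Or.inl mxb'
      · rintro e (rfl | rfl)
        · exact Or.inr (Or.inr rfl)
        · exact Or.inl mxa'
      · intro p r
        have t := h3.symm y w
        unfold recol
        grind

/-- The set `M`: missing at `x` or effectively missing at `y`. -/
def InM (small : V → Prop) (x y : V) (φ : V → V → ℕ) (c : ℕ) : Prop :=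
  Miss φ x c ∨ Pb small x φ y c

lemma normal (C : Ctx G k x small) (h : St G k x y φ) {α : ℕ} (a0 : α ≠ 0)
    (pb : Pb small x φ y α) :
    ∃ φ', St G k x y φ' ∧ (∀ a, φ' x a = φ x a) ∧ Miss φ' y α ∧
      (∀ c, Pb small x φ y c ↔ Pb small x φ' y c) ∧ Sim (InM small x y φ) φ φ' := by
  rcases pb with m | ⟨w, sw, hwx, hw⟩
  · exact ⟨φ, h, fun _ => rfl, m, fun _ => Iff.rfl, fun _ _ => Or.inl rfl⟩
  · obtain ⟨γ, -, gk, my⟩ := C.ymiss y φ h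
    obtain ⟨φ', h', ex, m, w1, y1, s1⟩ := smallStep C h gk my sw hwx hw a0
    refine ⟨φ', h', ex, m, ?_, ?_⟩
    · intro c
      constructor
      · rintro (mc | ⟨w', sw', hwx', hw'⟩)
        · by_cases hcg : c = γ
          · exact Or.inr ⟨w, sw, hwx, by rw [w1, hcg]⟩
          · refine Or.inl fun d => ?_
            have t1 := mc d
            have t2 := y1 d
            grind
        · by_cases e : w' = w
          · left
            rw [← hw', e, hw]
            exact m
          · exact Or.inr ⟨w', sw', hwx', by rw [y1 _ e, hw']⟩
      · rintro (mc | ⟨w', sw', hwx', hw'⟩)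
        · by_cases hcg : c = α
          · exact Or.inr ⟨w, sw, hwx, by rw [hw, hcg]⟩
          · refine Or.inl fun d => ?_
            have t1 := mc d
            have t2 := y1 d
            grind
        · by_cases e : w' = w
          · left
            rw [← hw', e, w1]
            exact my
          · exact Or.inr ⟨w', sw', hwx', by rw [← y1 _ e, hw']⟩
    · intro p r
      by_cases e : (p = y ∧ r = w) ∨ (p = w ∧ r = y)
      · right
        have i1 : InM small x y φ α := Or.inr (Or.inr ⟨w, sw, hwx, hw⟩)
        have i2 : InM small x y φ γ := Or.inr (Or.inl my)
        have t2 := h.symm y w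
        have t3 := h'.symm y w
        grind
      · have i2 : InM small x y φ γ := Or.inr (Or.inl my)
        have i3 : ∀ c, Miss φ x c → InM small x y φ c := fun c hc => Or.inl hc
        have := s1 p r e
        grind

lemma inM_congr {φ' : V → V → ℕ} (ex : ∀ a, φ' x a = φ x a)
    (hp : ∀ c, Pb small x φ y c ↔ Pb small x φ' y c) (c : ℕ) :
    InM small x y φ' c ↔ InM small x y φ c := by
  unfold InM
  rw [hp c]
  simp only [Miss, ex]

/-- The colors missing at `x` do not change under rotation. -/
lemma rot_missx (h : St G k x y φ) {z : V} {α c : ℕ} (hz : φ x z = α) (a0 : α ≠ 0)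
    (m : Miss φ x c) : Miss (rot φ x y z α) x c := by
  have c0 := h.miss0 m
  intro a
  have t1 := m a
  have t2 := m z
  unfold rot
  grind

lemma rot_pb (h : St G k x y φ) {z v : V} {α c : ℕ} (hz : φ x z = α) (c0 : c ≠ 0) (hvx : v ≠ x)
    (hca : c ≠ α) (pb : Pb small x φ v c) : Pb small x (rot φ x y z α) v c := by
  rcases pb with m | ⟨w, sw, hwx, hw⟩
  · left
    intro a
    have := m a
    unfold rot
    grind
  · right
    refine ⟨w, sw, hwx, ?_⟩
    unfold rot
    grind

lemma rot_missz (h : St G k x y φ) {z : V} {α : ℕ} (hz : φ x z = α) (a0 : α ≠ 0) :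
    Miss (rot φ x y z α) z α := by
  intro a
  have hxy := h.xy0
  have t := h.proper z x a
  have t2 := h.symm x z
  have t3 := h.irr x
  unfold rot
  grind

lemma claim1a (C : Ctx G k x small) (h : St G k x y φ) {z u : V} {α c : ℕ} (hz : φ x z = α)
    (mα : Miss φ y α) (su : small u) (hux : u ≠ x) (hc : φ z u = c) (mx : Miss φ x c) :
    False := by
  have a0 := h.miss0 mα
  have hzx : z ≠ x := by
    rintro rfl
    exact a0 (hz ▸ h.irr z)
  refine base C (rot_st h hz mα) su hux ?_ (rot_missx h hz a0 mx)
  unfold rot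
  grind

lemma ne_color (h : St G k x y φ) {z u : V} {α c : ℕ} (hz : φ x z = α) (a0 : α ≠ 0)
    (hux : u ≠ x) (hc : φ z u = c) : c ≠ α := by
  have t := h.proper z x u
  have t2 := h.symm x z
  grind

lemma claim1b (C : Ctx G k x small) (h : St G k x y φ) {z u : V} {α c : ℕ} (hz : φ x z = α)
    (mα : Miss φ y α) (su : small u) (hux : u ≠ x) (hc : φ z u = c) (c0 : c ≠ 0)
    (hM : InM small x y φ c) : False := by
  have a0 := h.miss0 mα
  rcases hM with mx | pb
  · exact claim1a C h hz mα su hux hc mx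
  · have hzy : z ≠ y := by
      rintro rfl
      exact a0 (hz ▸ h.xy0)
    obtain ⟨φ', h', ex, m', mx', -⟩ := conv C h (hz ▸ h.le x z) mα (ne_color h hz a0 hux hc) pb
      su hux hzy hc c0
    exact claim1a C h' (by rw [ex]; exact hz) m' su hux rfl (fun a => by rw [ex]; exact mx' a)

lemma claim1 (C : Ctx G k x small) (h : St G k x y φ) {z u : V} {α c : ℕ} (hz : φ x z = α)
    (a0 : α ≠ 0) (pα : Pb small x φ y α) (su : small u) (hux : u ≠ x) (hc : φ z u = c)
    (c0 : c ≠ 0) (hM : InM small x y φ c) : False := by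
  obtain ⟨φ', h', ex, m', hp, s⟩ := normal C h a0 pα
  have hne : φ' z u ≠ 0 := (h'.ne0 z u).2 ((h.ne0 z u).1 (by rw [hc]; exact c0))
  refine claim1b C h' (by rw [ex]; exact hz) m' su hux rfl hne ?_
  rw [inM_congr ex hp]
  have := s z u
  grind

/-- Claim 2 when `α` is missing at `y` and `c` is missing at `x` or effectively missing at `z`. -/
lemma claim2a (C : Ctx G k x small) (h : St G k x y φ) {z z' u : V} {α β c : ℕ} (hz : φ x z = α)
    (mα : Miss φ y α) (hz' : φ x z' = β) (b0 : β ≠ 0) (hab : β ≠ α) (pβ : Pb small x φ z β)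
    (su : small u) (hux : u ≠ x) (hc : φ z' u = c) (c0 : c ≠ 0)
    (hM : Miss φ x c ∨ c = α ∨ Pb small x φ z c) : False := by
  have a0 := h.miss0 mα
  have hzx : z ≠ x := by
    rintro rfl
    exact a0 (hz ▸ h.irr z)
  have hzx' : z' ≠ x := by
    rintro rfl
    exact b0 (hz' ▸ h.irr z')
  have hxy := h.xy0
  refine claim1 C (rot_st h hz mα) (z := z') (α := β) (c := c) ?_ b0
    (rot_pb h hz b0 hzx hab pβ) su hux ?_ c0 ?_
  · unfold rot
    grind
  · unfold rot
    grind
  · by_cases hca : c = α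
    · rw [hca]
      exact Or.inr (Or.inl (rot_missz h hz a0))
    · rcases hM with m | e | p
      · exact Or.inl (rot_missx h hz a0 m)
      · exact absurd e hca
      · exact Or.inr (rot_pb h hz c0 hzx hca p)

lemma claim2 (C : Ctx G k x small) (h : St G k x y φ) {z z' u : V} {α β c : ℕ} (hz : φ x z = α)
    (a0 : α ≠ 0) (pα : Pb small x φ y α) (hz' : φ x z' = β) (b0 : β ≠ 0)
    (hβ : ¬ InM small x y φ β) (pβ : Pb small x φ z β)
    (su : small u) (hux : u ≠ x) (hc : φ z' u = c) (c0 : c ≠ 0)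
    (hM : InM small x y φ c) : False := by
  have hab : β ≠ α := by
    rintro rfl
    exact hβ (Or.inr pα)
  obtain ⟨φ1, h1, x1, m1, hp, s⟩ := normal C h a0 pα
  have hne : φ1 z' u ≠ 0 := (h1.ne0 z' u).2 ((h.ne0 z' u).1 (by rw [hc]; exact c0))
  have hM1 : InM small x y φ1 (φ1 z' u) := by
    rw [inM_congr x1 hp]
    have := s z' u
    grind
  have hβ1 : ¬ InM small x y φ1 β := by rw [inM_congr x1 hp]; exact hβ
  have pβ1 := (s.pb hβ).1 pβ
  have hz1 : φ1 x z = α := by rw [x1, hz]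
  have hz1' : φ1 x z' = β := by rw [x1, hz']
  have hzy : z' ≠ y := by
    rintro rfl
    exact b0 (hz' ▸ h.xy0)
  by_cases hca : φ1 z' u = α
  · exact claim2a C h1 hz1 m1 hz1' b0 hab pβ1 su hux rfl hne (Or.inr (Or.inl hca))
  rcases hM1 with m | p
  · exact claim2a C h1 hz1 m1 hz1' b0 hab pβ1 su hux rfl hne (Or.inl m)
  · obtain ⟨φ2, h2, x2, m2, mx2, s2⟩ := conv C h1 (hz1 ▸ h1.le x z) m1 hca p su hux hzy rfl hne
    have hcb := ne_color h1 hz1' b0 hux rfl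
    have pβ2 := (s2.pb (c := β) (by
      rintro (e | e | e)
      · exact hβ1 (Or.inl e)
      · exact hab e
      · exact hcb e.symm)).1 pβ1
    refine claim2a C h2 (by rw [x2, hz1]) m2 (by rw [x2, hz1']) b0 hab pβ2 su hux rfl
      ((h2.ne0 z' u).2 ((h1.ne0 z' u).1 hne)) (Or.inl fun a => by rw [x2]; exact mx2 a)

lemma claim3 (C : Ctx G k x small) (h : St G k x y φ) {z z' z2 u : V} {α β c α2 : ℕ}
    (hz : φ x z = α)
    (a0 : α ≠ 0) (pα : Pb small x φ y α) (hz' : φ x z' = β) (b0 : β ≠ 0)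
    (hβ : ¬ InM small x y φ β) (pβ : Pb small x φ z β)
    (su : small u) (hux : u ≠ x) (hc : φ z' u = c) (c0 : c ≠ 0)
    (hcM : ¬ InM small x y φ c) (hz2 : φ x z2 = α2) (a20 : α2 ≠ 0) (pα2 : Pb small x φ y α2)
    (pc : Pb small x φ z2 c) : False := by
  have hab2 : β ≠ α2 := by
    rintro rfl
    exact hβ (Or.inr pα2)
  have hca2 : c ≠ α2 := by
    rintro rfl
    exact hcM (Or.inr pα2)
  have hca : c ≠ α := by
    rintro rfl
    exact hcM (Or.inr pα)
  have hcb := ne_color h hz' b0 hux hc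
  -- normalize so that `α2` is missing at `y`
  obtain ⟨φ1, h1, x1, m1, hp, s⟩ := normal C h a20 pα2
  have pβ1 := (s.pb hβ).1 pβ
  have pc1 := (s.pb hcM).1 pc
  have hc1 := (s.keep hcM z' u).1 hc
  have pα1 := (hp α).1 pα
  have hβ1 : ¬ InM small x y φ1 β := by rw [inM_congr x1 hp]; exact hβ
  have hz1 : φ1 x z = α := by rw [x1, hz]
  have hz1' : φ1 x z' = β := by rw [x1, hz']
  have hz12 : φ1 x z2 = α2 := by rw [x1, hz2]
  clear s hp
  by_cases hzz : z2 = z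
  · subst hzz
    exact claim2a C h1 hz12 m1 hz1' b0 hab2 pβ1 su hux hc1 c0 (Or.inr (Or.inr pc1))
  have hxy0 := h1.xy0
  have hxx0 := h1.irr x
  have haa2 : α ≠ α2 := by
    rintro rfl
    exact hzz (h1.proper x z2 z (by rw [hz12, hz1]) (by rw [hz12]; exact a20))
  have hz2x : z2 ≠ x := by grind
  have hzx : z ≠ x := by grind
  have hzx' : z' ≠ x := by grind
  have hyx : y ≠ x := h1.adj.ne.symm
  -- rotate to `z2`
  have h2 := rot_st h1 hz12 m1
  set φ2 := rot φ1 x y z2 α2 with hφ2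
  have hc2 : φ2 z' u = c := by
    rw [hφ2]; unfold rot; grind
  obtain ⟨φ3, h3, x3, m3, mx3, s3⟩ := conv C h2 (hz12 ▸ h1.le x z2) (rot_missz h1 hz12 a20) hca2
    (rot_pb h1 hz12 c0 hz2x hca2 pc1) su hux (by grind) hc2 c0
  have hxy2 : φ2 x y = α2 := by
    rw [hφ2]; unfold rot; simp
  have hxz2 : φ2 x z = α := by
    rw [hφ2]; unfold rot; grind
  have hxz2' : φ2 x z' = β := by
    rw [hφ2]; unfold rot; grind
  have hxy3 : φ3 x y = α2 := by rw [x3, hxy2]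
  have keepα : ¬ (Miss φ2 x α ∨ α = α2 ∨ α = c) := by
    rintro (e | e | e)
    · exact e z hxz2
    · exact haa2 e
    · exact hca e.symm
  have keepβ : ¬ (Miss φ2 x β ∨ β = α2 ∨ β = c) := by
    rintro (e | e | e)
    · exact e z' hxz2'
    · exact hab2 e
    · exact hcb e.symm
  have pα3 := (s3.pb keepα).1 (rot_pb h1 hz12 a0 hyx haa2 pα1)
  have pβ3 := (s3.pb keepβ).1 (rot_pb h1 hz12 b0 hzx hab2 pβ1)
  -- rotate back to `y`
  have h4 := rot_st h3 hxy3 m3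
  have hxz20 := h3.xy0
  have pα4 := rot_pb h3 hxy3 a0 hyx haa2 pα3
  have pβ4 := rot_pb h3 hxy3 b0 hzx hab2 pβ3
  have hx4 : ∀ a, rot φ3 x z2 y α2 x a = φ1 x a := by
    intro a
    have t := x3 a
    rw [hφ2] at t
    unfold rot at t ⊢
    grind
  have hy4 : ∀ a, φ1 y a = β → rot φ3 x z2 y α2 y a = β := by
    intro a ha
    have hax : a ≠ x := by
      rintro rfl
      rw [h1.symm, hxy0] at ha
      exact b0 ha.symm
    have : φ2 y a = β := by
      rw [hφ2]; unfold rot; grind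
    have := (s3.keep keepβ y a).1 this
    unfold rot
    grind
  have hy4' : ∀ a, a ≠ x → rot φ3 x z2 y α2 y a = β → φ1 y a = β := by
    intro a hax ha
    have : φ3 y a = β := by
      unfold rot at ha; grind
    have := (s3.keep keepβ y a).2 this
    rw [hφ2] at this; unfold rot at this; grind
  have hc4 : rot φ3 x z2 y α2 z' u = φ3 z' u := by
    unfold rot; grind
  have hne4 : φ3 z' u ≠ 0 := h2.miss0 mx3
  refine claim2 C h4 (z := z) (z' := z') (α := α) (β := β) (by rw [hx4, hz1]) a0 pα4
    (by rw [hx4, hz1']) b0 ?_ pβ4 su hux hc4 hne4 ?_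
  · rintro (e | e | ⟨w, sw, hwx, hw⟩)
    · exact e z' (by rw [hx4, hz1'])
    · exact hβ1 (Or.inr (Or.inl fun a ha => e a (hy4 a ha)))
    · exact hβ1 (Or.inr (Or.inr ⟨w, sw, hwx, hy4' w hwx hw⟩))
  · refine Or.inl (rot_missx h3 hxy3 a20 fun a => ?_)
    rw [x3]
    exact mx3 a

open Classical in
lemma card_present [DecidableRel G.Adj] (h : St G k x y φ) (v : V) :
    (((Finset.univ.image (φ v)).erase 0).card ≤ G.degree v) ∧
    ((v = x ∨ v = y) → ((Finset.univ.image (φ v)).erase 0).card + 1 ≤ G.degree v) := by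
  have key : ∀ S : Finset V, (∀ a, φ v a ≠ 0 → a ∈ S) →
      ((Finset.univ.image (φ v)).erase 0).card ≤ S.card := by
    intro S hS
    refine (Finset.card_le_card ?_).trans (Finset.card_image_le (s := S) (f := φ v))
    intro c hc
    simp only [Finset.mem_erase, Finset.mem_image, Finset.mem_univ, true_and] at hc
    obtain ⟨c0, a, rfl⟩ := hc
    exact Finset.mem_image_of_mem _ (hS a c0)
  constructor
  · rw [← SimpleGraph.card_neighborFinset_eq_degree]
    refine key _ fun a ha => ?_
    rw [SimpleGraph.mem_neighborFinset]
    exact ((h.ne0 v a).1 ha).1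
  · rintro (rfl | rfl)
    · have hm : y ∈ G.neighborFinset v := by
        rw [SimpleGraph.mem_neighborFinset]; exact h.adj
      rw [← SimpleGraph.card_neighborFinset_eq_degree, ← Finset.card_erase_add_one hm]
      refine Nat.succ_le_succ (key _ fun a ha => ?_)
      rw [Finset.mem_erase, SimpleGraph.mem_neighborFinset]
      have := (h.ne0 v a).1 ha
      exact ⟨fun e => this.2 (Or.inl ⟨rfl, e⟩), this.1⟩
    · have hm : x ∈ G.neighborFinset v := by
        rw [SimpleGraph.mem_neighborFinset]; exact h.adj.symm
      rw [← SimpleGraph.card_neighborFinset_eq_degree, ← Finset.card_erase_add_one hm]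
      refine Nat.succ_le_succ (key _ fun a ha => ?_)
      rw [Finset.mem_erase, SimpleGraph.mem_neighborFinset]
      have := (h.ne0 v a).1 ha
      exact ⟨fun e => this.2 (Or.inr ⟨rfl, e⟩), this.1⟩

open Classical in
lemma exists_color (S : Finset ℕ) (k : ℕ) (hS : S.card < k) :
    ∃ c, c ≠ 0 ∧ c ≤ k ∧ c ∉ S := by
  obtain ⟨c, hc, hn⟩ := Finset.exists_mem_notMem_of_card_lt_card
    (s := S) (t := Finset.Icc 1 k) (by simpa using hS)
  rw [Finset.mem_Icc] at hc
  exact ⟨c, by omega, hc.2, hn⟩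

open Classical in
lemma miss_of_notMem (φ : V → V → ℕ) (v : V) {c : ℕ} (c0 : c ≠ 0)
    (h : c ∉ (Finset.univ.image (φ v)).erase 0) : Miss φ v c := by
  intro a ha
  exact h (by simp only [Finset.mem_erase, Finset.mem_image, Finset.mem_univ, true_and]; exact ⟨c0, a, ha⟩)

open Classical in
lemma mkCtx [DecidableRel G.Adj] (hk : G.maxDegree = k)
    (hno : ∀ ψ, ¬ IsEdgeColoring G k ψ)
    (hsum : ∀ u, small u → G.degree x + G.degree u < k) : Ctx G k x small := by
  have nc : ∀ y φ, St G k x y φ → ∀ c, c ≠ 0 → c ≤ k → Miss φ x c → Miss φ y c → False := by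
    intro y φ h c c0 ck mx my
    have hxy := h.adj.ne
    apply hno (fun p r => if (p = x ∧ r = y) ∨ (p = y ∧ r = x) then c else φ p r)
    refine ⟨?_, ?_, ?_⟩
    · intro p r
      have := h.symm p r
      grind
    · intro p r hpr
      have t1 := h.le p r
      have t2 := h.ne0 p r
      rw [Finset.mem_Icc]
      grind
    · intro v a b ha hb hab
      have t1 := h.proper v a b
      have t2 := h.ne0 v a
      have t3 := h.ne0 v b
      have t4 := mx a
      have t5 := mx b
      have t6 := my a
      have t7 := my b
      grind
  refine ⟨nc, ?_, ?_, ?_⟩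
  · intro y φ h u su hux f
    have h1 := (card_present h x).2 (Or.inl rfl)
    have h2 := (card_present h u).1
    have h3 := hsum u su
    obtain ⟨c, c0, ck, hc⟩ := exists_color
      (insert f ((Finset.univ.image (φ x)).erase 0 ∪ (Finset.univ.image (φ u)).erase 0)) k (by
        have t1 := Finset.card_insert_le f
          ((Finset.univ.image (φ x)).erase 0 ∪ (Finset.univ.image (φ u)).erase 0)
        have t2 := Finset.card_union_le ((Finset.univ.image (φ x)).erase 0)
          ((Finset.univ.image (φ u)).erase 0)
        omega)
    rw [Finset.mem_insert, Finset.mem_union] at hc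
    push Not at hc
    exact ⟨c, hc.1, c0, ck, miss_of_notMem φ x c0 hc.2.1, miss_of_notMem φ u c0 hc.2.2⟩
  · intro y φ h sy
    have h1 := (card_present h x).2 (Or.inl rfl)
    have h2 := (card_present h y).1
    have h3 := hsum y sy
    obtain ⟨c, c0, ck, hc⟩ := exists_color
      ((Finset.univ.image (φ x)).erase 0 ∪ (Finset.univ.image (φ y)).erase 0) k (by
        have t2 := Finset.card_union_le ((Finset.univ.image (φ x)).erase 0)
          ((Finset.univ.image (φ y)).erase 0)
        omega)
    rw [Finset.mem_union] at hc
    push Not at hc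
    exact nc y φ h c c0 ck (miss_of_notMem φ x c0 hc.1) (miss_of_notMem φ y c0 hc.2)
  · intro y φ h
    have h1 := (card_present h y).2 (Or.inr rfl)
    have h2 := G.degree_le_maxDegree y
    obtain ⟨c, c0, ck, hc⟩ := exists_color ((Finset.univ.image (φ y)).erase 0) k (by omega)
    exact ⟨c, c0, ck, miss_of_notMem φ y c0 hc⟩

end Helpers

/-- Let `G` be a `Δ`-critical simple graph, `ε ∈ (0,1)`, `q = (1-ε)Δ`, `xy ∈ E(G)` with
`d(x) < εΔ`, and `φ ∈ C^Δ(G - xy)`. If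
`(⋃_{z ∈ N(x, M_φ)} φ_b(z)) ∩ B_φ(x,y,q) = B_φ(x,y,q)` and `|B_φ(x,y,q)| = 2`, then there
exists at least one `z' ∈ N(x, B_φ)` such that every `u ∈ N(z') - {x}` satisfies
`d(u) ≥ q`. -/
theorem statement11 (G : SimpleGraph V) [DecidableRel G.Adj] (hG : IsDeltaCritical G)
    (ε : ℝ) (hε : ε ∈ Set.Ioo (0 : ℝ) 1) (q : ℝ) (hq : q = (1 - ε) * G.maxDegree)
    (x y : V) (hxy : G.Adj x y) (hx : (G.degree x : ℝ) < ε * G.maxDegree)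
    (H : SimpleGraph V) (hH : H = G.deleteEdges {s(x, y)})
    (φ : V → V → ℕ) (hφ : IsEdgeColoring H G.maxDegree φ)
    (hcover : (⋃ z ∈ NxM G H G.maxDegree φ q x y, phib G H G.maxDegree φ q z) ∩
        Bset G H φ q x y = Bset G H φ q x y)
    (hB : (Bset G H φ q x y).ncard = 2) :
    ∃ z' ∈ NxB G H φ q x y, ∀ u : V, G.Adj z' u → u ≠ x → q ≤ (G.degree u : ℝ) := by
  classical
  have hno : ∀ ψ, ¬ IsEdgeColoring G G.maxDegree ψ := by
    intro ψ hψ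
    have h1 : chromIndex G ≤ G.maxDegree := Nat.sInf_le ⟨ψ, hψ⟩
    have h2 := hG.2.1
    omega
  set k := G.maxDegree with hk
  let small : V → Prop := fun u => (G.degree u : ℝ) < q
  have C : Ctx G k x small := by
    refine mkCtx hk.symm hno fun u hu => ?_
    have hu' : (G.degree u : ℝ) < q := hu
    have : (G.degree x : ℝ) + G.degree u < k := by rw [hq] at hu'; linarith
    exact_mod_cast this
  have hadj : ∀ u v, H.Adj u v ↔ G.Adj u v ∧ ¬ ((u = x ∧ v = y) ∨ (u = y ∧ v = x)) := by
    intro u v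
    rw [hH, SimpleGraph.deleteEdges_adj, Set.mem_singleton_iff, Sym2.eq_iff]
  obtain ⟨hs, hI, hP⟩ := hφ
  let ψ : V → V → ℕ := fun u v => if H.Adj u v then φ u v else 0
  have ψpos : ∀ {u v}, H.Adj u v → ψ u v = φ u v := fun h => if_pos h
  have φ0 : ∀ {u v}, H.Adj u v → φ u v ≠ 0 ∧ φ u v ≤ k := by
    intro u v h
    have := Finset.mem_Icc.1 (hI h)
    omega
  have ψadj : ∀ {u v}, ψ u v ≠ 0 → H.Adj u v := by
    intro u v h
    by_contra hn
    exact h (if_neg hn)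
  have h : St G k x y ψ := by
    refine ⟨hxy, ?_, ?_, ?_, ?_⟩
    · intro u v
      have := H.adj_comm u v
      simp only [ψ, this, hs u v]
    · intro u v
      by_cases e : H.Adj u v
      · rw [ψpos e]; exact (φ0 e).2
      · simp [ψ, e]
    · intro u v
      rw [← hadj]
      exact ⟨ψadj, fun e => by rw [ψpos e]; exact (φ0 e).1⟩
    · intro v a b hab hne
      by_contra hn
      have ha := ψadj hne
      have hb := ψadj (hab ▸ hne)
      rw [ψpos ha, ψpos hb] at hab
      exact hP ha hb hn hab
  have missψ : ∀ v c, c ≠ 0 → (Miss ψ v c ↔ c ∉ present H φ v) := by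
    intro v c c0
    constructor
    · rintro m ⟨u, hu, e⟩
      exact m u (by rw [ψpos hu, e])
    · intro m u e
      have hu := ψadj (by rw [e]; exact c0 : ψ v u ≠ 0)
      exact m ⟨u, hu, by rw [← ψpos hu, e]⟩
  have hsm : ∀ v w c, c ≠ 0 → ψ v w = c → H.Adj v w ∧ φ v w = c := by
    intro v w c c0 e
    have hu := ψadj (by rw [e]; exact c0 : ψ v w ≠ 0)
    exact ⟨hu, by rw [← ψpos hu, e]⟩
  have ynx : ∀ w, H.Adj y w → w ≠ x := by
    rintro w hw rfl
    exact ((hadj y w).1 hw).2 (Or.inr ⟨rfl, rfl⟩)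
  -- colors of `B` are not in `M`
  have BM : ∀ β ∈ Bset G H φ q x y, β ≠ 0 ∧ ¬ InM small x y ψ β := by
    rintro β ⟨hpx, u, hu, hub, hqu⟩
    have b0 : β ≠ 0 := hub ▸ (φ0 hu).1
    refine ⟨b0, ?_⟩
    rintro (m | m | ⟨w, sw, hwx, hw⟩)
    · exact (missψ x β b0).1 m hpx
    · exact (missψ y β b0).1 m ⟨u, hu, hub⟩
    · obtain ⟨h1, h2⟩ := hsm y w β b0 hw
      have : u = w := by
        by_contra hn
        exact hP hu h1 hn (by rw [hub, h2])
      have sw' : (G.degree w : ℝ) < q := sw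
      rw [← this] at sw'
      linarith
  -- colors not in `M` are in `B`
  have MB : ∀ β, β ≠ 0 → β ≤ k → ¬ InM small x y ψ β → β ∈ Bset G H φ q x y := by
    intro β b0 bk hM
    have hpx : β ∈ present H φ x := by
      by_contra hn
      exact hM (Or.inl ((missψ x β b0).2 hn))
    have hpy : β ∈ present H φ y := by
      by_contra hn
      exact hM (Or.inr (Or.inl ((missψ y β b0).2 hn)))
    obtain ⟨u, hu, hub⟩ := hpy
    refine ⟨hpx, u, hu, hub, ?_⟩
    by_contra hn
    exact hM (Or.inr (Or.inr ⟨u, not_le.1 hn, ynx u hu, by rw [ψpos hu, hub]⟩))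
  -- covering
  have cov : ∀ β ∈ Bset G H φ q x y, ∃ z, ψ x z ≠ 0 ∧ Pb small x ψ y (ψ x z) ∧
      Pb small x ψ z β := by
    intro β hβ
    obtain ⟨b0, hbM⟩ := BM β hβ
    have hβ' := hβ
    rw [← hcover] at hβ'
    obtain ⟨z, hzM, hzb⟩ := Set.mem_iUnion₂.1 hβ'.1
    obtain ⟨hxz, hM⟩ := hzM
    have a0 := (φ0 hxz).1
    have pα : Pb small x ψ y (φ x z) := by
      rcases hM with (⟨-, u, hu, e, sm⟩ | m) | m
      · exact Or.inr ⟨u, sm, ynx u hu, by rw [ψpos hu, e]⟩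
      · exact absurd ⟨z, hxz, rfl⟩ m.2
      · exact Or.inl ((missψ y _ a0).2 m.2)
    refine ⟨z, by rw [ψpos hxz]; exact a0, by rw [ψpos hxz]; exact pα, ?_⟩
    obtain ⟨-, m | ⟨v', hv, e, sm⟩⟩ := hzb
    · exact Or.inl ((missψ z β b0).2 m)
    · refine Or.inr ⟨v', sm, ?_, by rw [ψpos hv, e]⟩
      rintro rfl
      rw [hs z v'] at e
      rw [e] at pα
      exact hbM (Or.inr pα)
  obtain ⟨β, hβ⟩ : (Bset G H φ q x y).Nonempty := by
    apply Set.nonempty_of_ncard_ne_zero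
    omega
  obtain ⟨b0, hbM⟩ := BM β hβ
  obtain ⟨z', hz', hzb⟩ := hβ.1
  refine ⟨z', ⟨hz', by rw [hzb]; exact hβ⟩, ?_⟩
  intro u hu hux
  by_contra hn
  have su : small u := not_le.1 hn
  have huy : u ≠ y := by
    rintro rfl
    exact C.nsm u ψ h su
  have hzx' : z' ≠ x := hz'.ne.symm
  have hu' : H.Adj z' u := (hadj z' u).2 ⟨hu, by rintro (e | e); exacts [hzx' e.1, hux e.2]⟩
  have c0 : ψ z' u ≠ 0 := by rw [ψpos hu']; exact (φ0 hu').1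
  have hz'ψ : ψ x z' = β := by rw [ψpos hz', hzb]
  obtain ⟨z, a0, pα, pβ⟩ := cov β hβ
  by_cases hcM : InM small x y ψ (ψ z' u)
  · exact claim2 C h rfl a0 pα hz'ψ b0 hbM pβ su hux rfl c0 hcM
  · obtain ⟨z2, a20, pα2, pc⟩ := cov _ (MB _ c0 (h.le z' u) hcM)
    exact claim3 C h rfl a0 pα hz'ψ b0 hbM pβ su hux rfl c0 hcM rfl a20 pα2 pc
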